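/- Let p, k ≥ 1 be integers and let n ≥ pk + 1. The number of k-element subsets S of the cyclic group Z_n such that for every ordered pair (x, y) of distinct elements of S the difference x − y (computed modulo n, with representative in {1, …, n}) does not lie in {1, 2, …, p} is equal to (n/(n − pk)) · C(n − pk, k). -/

import Mathlib

/-- `k`-subsets of `{0,…,m-1}` with gaps larger than `p`. -/
def linSets (p m k : ℕ) : Finset (Finset ℕ) :=
  (Finset.powersetCard k (Finset.range m)).filter (fun S => ∀ x ∈ S, ∀ y ∈ S, x < y → x + p < y)

lemma mem_linSets (p m k : ℕ) (S : Finset ℕ) : S ∈ linSets p m k ↔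
    (∀ x ∈ S, x < m) ∧ S.card = k ∧ ∀ x ∈ S, ∀ y ∈ S, x < y → x + p < y := by
  simp only [linSets, Finset.mem_filter, Finset.mem_powersetCard, and_assoc]
  simp [Finset.subset_iff]

lemma linSets_succ (p m k : ℕ) : linSets p (m+1) (k+1) =
    linSets p m (k+1) ∪ (linSets p (m-p) k).image (insert m) := by
  ext S
  simp only [Finset.mem_union, Finset.mem_image, mem_linSets]
  constructor
  · rintro ⟨h1, h2, h3⟩
    by_cases hm : m ∈ S
    · right
      refine ⟨S.erase m, ⟨?_, ?_, ?_⟩, Finset.insert_erase hm⟩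
      · intro x hx
        rw [Finset.mem_erase] at hx
        have := h1 x hx.2
        have := h3 x hx.2 m hm (by omega)
        omega
      · rw [Finset.card_erase_of_mem hm]; omega
      · intro x hx y hy
        exact h3 x (Finset.mem_of_mem_erase hx) y (Finset.mem_of_mem_erase hy)
    · left
      refine ⟨fun x hx => ?_, h2, h3⟩
      have := h1 x hx
      have : x ≠ m := fun h => hm (h ▸ hx)
      omega
  · rintro (⟨h1, h2, h3⟩ | ⟨T, ⟨h1, h2, h3⟩, rfl⟩)
    · exact ⟨fun x hx => by have := h1 x hx; omega, h2, h3⟩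
    · have hm : m ∉ T := fun h => by have := h1 m h; omega
      refine ⟨?_, ?_, ?_⟩
      · intro x hx
        rcases Finset.mem_insert.1 hx with rfl | hx
        · omega
        · have := h1 x hx; omega
      · rw [Finset.card_insert_of_notMem hm, h2]
      · intro x hx y hy hxy
        rcases Finset.mem_insert.1 hx with ex | hx' <;>
          rcases Finset.mem_insert.1 hy with ey | hy'
        · omega
        · have := h1 y hy'; omega
        · have := h1 x hx'; omega
        · exact h3 x hx' y hy' hxy

lemma card_linSets_succ (p m k : ℕ) : (linSets p (m+1) (k+1)).card =
    (linSets p m (k+1)).card + (linSets p (m-p) k).card := by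
  rw [linSets_succ, Finset.card_union_of_disjoint, Finset.card_image_of_injOn]
  · intro S hS T hT h
    have hS := ((mem_linSets _ _ _ _).1 (Finset.mem_coe.1 hS)).1
    have hT := ((mem_linSets _ _ _ _).1 (Finset.mem_coe.1 hT)).1
    have h1 : m ∉ S := fun h => by have := hS m h; omega
    have h2 : m ∉ T := fun h => by have := hT m h; omega
    rw [← Finset.erase_insert h1, ← Finset.erase_insert h2]
    exact congrArg (fun U => Finset.erase U m) h
  · rw [Finset.disjoint_left]
    intro S hS hS'
    obtain ⟨T, -, rfl⟩ := Finset.mem_image.1 hS'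
    have := ((mem_linSets _ _ _ _).1 hS).1 m (Finset.mem_insert_self _ _)
    omega

lemma card_linSets (p : ℕ) (m : ℕ) : ∀ k, (linSets p m k).card = (m + p - p * k).choose k := by
  induction m using Nat.strong_induction_on with
  | _ m ih =>
    intro k
    rcases k with _ | k
    · have : linSets p m 0 = {∅} := by
        ext S
        rw [mem_linSets, Finset.mem_singleton, Finset.card_eq_zero]
        constructor
        · exact fun h => h.2.1
        · rintro rfl; simp
      simp [this]
    rcases m with _ | m
    · have : p - p * (k+1) = 0 := by rw [mul_add]; omega
      simp [linSets, this]
    rw [card_linSets_succ, ih m (by omega), ih (m-p) (by omega)]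
    have e1 : m + 1 + p - p * (k+1) = m + 1 - p * k := by rw [mul_add]; omega
    have e2 : m + p - p * (k+1) = m - p * k := by rw [mul_add]; omega
    rw [e1, e2]
    rcases k with _ | k
    · simp
    have hle : p ≤ p * (k+1) := Nat.le_mul_of_pos_right _ (by omega)
    by_cases h : p * (k+1) ≤ m
    · have e3 : m + 1 - p * (k+1) = (m - p * (k+1)) + 1 := by omega
      have e4 : m - p + p - p * (k+1) = m - p * (k+1) := by omega
      rw [e3, e4, Nat.choose_succ_succ, add_comm]
    · have e3 : m + 1 - p * (k+1) = 0 := by omega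
      have e4 : m - p + p - p * (k+1) = 0 := by omega
      have e5 : m - p * (k+1) = 0 := by omega
      simp [e3, e4, e5]

/-- The cyclic separation condition. -/
def CycGood (p n : ℕ) (S : Finset (ZMod n)) : Prop :=
  ∀ x ∈ S, ∀ y ∈ S, x ≠ y → ∀ a : ℕ, 1 ≤ a → a ≤ p → x - y ≠ (a : ZMod n)

lemma cycGood_iff (p n : ℕ) [NeZero n] (hp : p < n) (S : Finset (ZMod n)) :
    CycGood p n S ↔ ∀ x ∈ S, ∀ y ∈ S, x.val < y.val →
      x.val + p < y.val ∧ y.val + p < x.val + n := by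
  constructor
  · intro h x hx y hy hxy
    have hy' := y.val_lt
    have hne : x ≠ y := by rintro rfl; omega
    constructor
    · by_contra hc
      refine h y hy x hx hne.symm (y.val - x.val) (by omega) (by omega) ?_
      rw [Nat.cast_sub hxy.le]; simp
    · by_contra hc
      refine h x hx y hy hne (x.val + n - y.val) (by omega) (by omega) ?_
      rw [Nat.cast_sub (by omega)]; simp
  · intro h x hx y hy hne a h1 h2 he
    have hx' := x.val_lt
    have hy' := y.val_lt
    have e : x = y + (a : ZMod n) := by rw [← he]; ring
    have ev : x.val = (y.val + a) % n := by
      rw [e, ZMod.val_add, ZMod.val_natCast]; simp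
    rcases lt_or_ge (y.val + a) n with h3 | h3
    · rw [Nat.mod_eq_of_lt h3] at ev
      have := h y hy x hx (by omega)
      omega
    · rw [Nat.mod_eq_sub_mod h3, Nat.mod_eq_of_lt (by omega)] at ev
      have := h x hx y hy (by omega)
      omega

open Classical in
/-- Good cyclic sets of size `k`. -/
noncomputable def cycSets (p n k : ℕ) [NeZero n] : Finset (Finset (ZMod n)) :=
  Finset.univ.filter (fun S => S.card = k ∧ CycGood p n S)

lemma cycGood_translate (p n : ℕ) (S : Finset (ZMod n)) (c : ZMod n)
    (h : CycGood p n S) : CycGood p n (S.image (· + c)) := by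
  intro x hx y hy hne a h1 h2 he
  obtain ⟨x, hx', rfl⟩ := Finset.mem_image.1 hx
  obtain ⟨y, hy', rfl⟩ := Finset.mem_image.1 hy
  exact h x hx' y hy' (fun e => hne (by rw [e])) a h1 h2 (by rw [← he]; ring)

lemma card_contains (p n k : ℕ) [NeZero n] (c : ZMod n) :
    ((cycSets p n k).filter (fun S => c ∈ S)).card =
    ((cycSets p n k).filter (fun S => (0 : ZMod n) ∈ S)).card := by
  classical
  refine Finset.card_bij' (fun S _ => S.image (· + -c)) (fun S _ => S.image (· + c)) ?_ ?_ ?_ ?_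
  · intro S hS
    simp only [cycSets, Finset.mem_filter, Finset.mem_univ, true_and] at hS ⊢
    refine ⟨⟨?_, cycGood_translate _ _ _ _ hS.1.2⟩, Finset.mem_image.2 ⟨c, hS.2, by simp⟩⟩
    rw [Finset.card_image_of_injective _ (add_left_injective _), hS.1.1]
  · intro S hS
    simp only [cycSets, Finset.mem_filter, Finset.mem_univ, true_and] at hS ⊢
    refine ⟨⟨?_, cycGood_translate _ _ _ _ hS.1.2⟩, Finset.mem_image.2 ⟨0, hS.2, by simp⟩⟩
    rw [Finset.card_image_of_injective _ (add_left_injective _), hS.1.1]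
  · intro S hS
    simp only [Finset.image_image, Function.comp_def]
    simp only [neg_add_cancel_right, add_neg_cancel_right, Finset.image_id']
  · intro S hS
    simp only [Finset.image_image, Function.comp_def]
    simp only [neg_add_cancel_right, add_neg_cancel_right, Finset.image_id']

lemma double_count (p n k : ℕ) [NeZero n] :
    k * (cycSets p n k).card = n * ((cycSets p n k).filter (fun S => (0 : ZMod n) ∈ S)).card := by
  classical
  have h := Finset.sum_card_bipartiteAbove_eq_sum_card_bipartiteBelow
    (s := cycSets p n k) (t := (Finset.univ : Finset (ZMod n))) (fun S x => x ∈ S)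
  have h1 : ∀ S ∈ cycSets p n k,
      (Finset.bipartiteAbove (fun (S : Finset (ZMod n)) x => x ∈ S) Finset.univ S).card = k := by
    intro S hS
    simp only [cycSets, Finset.mem_filter, Finset.mem_univ, true_and] at hS
    simp [Finset.bipartiteAbove, hS.1]
  have h2 : ∀ x ∈ (Finset.univ : Finset (ZMod n)),
      (Finset.bipartiteBelow (fun (S : Finset (ZMod n)) x => x ∈ S) (cycSets p n k) x).card
        = ((cycSets p n k).filter (fun S => (0 : ZMod n) ∈ S)).card := by
    intro x _
    exact card_contains p n k x
  rw [Finset.sum_congr rfl h1, Finset.sum_congr rfl h2] at h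
  simp only [Finset.sum_const, smul_eq_mul, Finset.card_univ, ZMod.card] at h
  rw [mul_comm, h]

lemma card_zero (p n k : ℕ) [NeZero n] (hp : p < n) :
    ((cycSets p n (k+1)).filter (fun S => (0 : ZMod n) ∈ S)).card =
    (linSets p (n - 1 - 2 * p) k).card := by
  classical
  have hval : ∀ t, t < n - 1 - 2 * p → ((t + p + 1 : ℕ) : ZMod n).val = t + p + 1 := by
    intro t ht
    exact ZMod.val_natCast_of_lt (by omega)
  have hbd : ∀ S : Finset (ZMod n), CycGood p n S → (0 : ZMod n) ∈ S → ∀ x ∈ S, x ≠ 0 →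
      p < x.val ∧ x.val + p < n := by
    intro S hS h0 x hx hx0
    have := (cycGood_iff p n hp S).1 hS 0 h0 x hx
      (by rw [ZMod.val_zero]; exact Nat.pos_of_ne_zero (by simpa using hx0))
    rw [ZMod.val_zero] at this
    omega
  symm
  refine Finset.card_bij'
    (fun T _ => insert 0 (T.image (fun t => ((t + p + 1 : ℕ) : ZMod n))))
    (fun S _ => (S.erase 0).image (fun x => x.val - (p+1))) ?_ ?_ ?_ ?_
  · intro T hT
    obtain ⟨h1, h2, h3⟩ := (mem_linSets _ _ _ _).1 hT
    simp only [cycSets, Finset.mem_filter, Finset.mem_univ, true_and]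
    refine ⟨⟨?_, ?_⟩, Finset.mem_insert_self _ _⟩
    · rw [Finset.card_insert_of_notMem, Finset.card_image_of_injOn, h2]
      · intro a ha b hb hab
        have := congrArg ZMod.val hab
        simp only [hval a (h1 a ha), hval b (h1 b hb)] at this
        omega
      · intro h
        obtain ⟨t, ht, e⟩ := Finset.mem_image.1 h
        have := congrArg ZMod.val e
        rw [hval t (h1 t ht), ZMod.val_zero] at this
        omega
    · rw [cycGood_iff p n hp]
      intro x hx y hy
      rcases Finset.mem_insert.1 hx with rfl | hx <;> rcases Finset.mem_insert.1 hy with rfl | hy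
      · omega
      · obtain ⟨t, ht, rfl⟩ := Finset.mem_image.1 hy
        have := h1 t ht
        rw [hval t this, ZMod.val_zero]
        omega
      · rw [ZMod.val_zero]; omega
      · obtain ⟨t, ht, rfl⟩ := Finset.mem_image.1 hy
        obtain ⟨s, hs, rfl⟩ := Finset.mem_image.1 hx
        have a1 := h1 t ht
        have a2 := h1 s hs
        rw [hval t a1, hval s a2]
        intro h
        have := h3 s hs t ht (by omega)
        omega
  · intro S hS
    simp only [cycSets, Finset.mem_filter, Finset.mem_univ, true_and] at hS
    obtain ⟨⟨h1, h2⟩, h0⟩ := hS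
    have hb := hbd S h2 h0
    have h2' := (cycGood_iff p n hp S).1 h2
    rw [mem_linSets]
    refine ⟨?_, ?_, ?_⟩
    · intro t ht
      obtain ⟨x, hx, rfl⟩ := Finset.mem_image.1 ht
      have := hb x (Finset.mem_of_mem_erase hx) (Finset.ne_of_mem_erase hx)
      omega
    · rw [Finset.card_image_of_injOn, Finset.card_erase_of_mem h0, h1]; · omega
      intro x hx y hy hxy
      have hx := Finset.mem_erase.1 (Finset.mem_coe.1 hx)
      have hy := Finset.mem_erase.1 (Finset.mem_coe.1 hy)
      have a1 := hb x hx.2 hx.1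
      have a2 := hb y hy.2 hy.1
      apply ZMod.val_injective n
      simp only at hxy
      omega
    · intro s hs t ht hst
      obtain ⟨x, hx, rfl⟩ := Finset.mem_image.1 hs
      obtain ⟨y, hy, rfl⟩ := Finset.mem_image.1 ht
      have hx := Finset.mem_erase.1 hx
      have hy := Finset.mem_erase.1 hy
      have a1 := hb x hx.2 hx.1
      have a2 := hb y hy.2 hy.1
      have := h2' x hx.2 y hy.2 (by omega)
      omega
  · intro T hT
    obtain ⟨h1, h2, h3⟩ := (mem_linSets _ _ _ _).1 hT
    have hne : (0 : ZMod n) ∉ T.image (fun t => ((t + p + 1 : ℕ) : ZMod n)) := by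
      intro h
      obtain ⟨t, ht, e⟩ := Finset.mem_image.1 h
      have := congrArg ZMod.val e
      rw [hval t (h1 t ht), ZMod.val_zero] at this
      omega
    simp only [Finset.erase_insert hne, Finset.image_image]
    conv_rhs => rw [← Finset.image_id (s := T)]
    apply Finset.image_congr
    intro t ht
    simp only [Function.comp, hval t (h1 t ht), id]
    omega
  · intro S hS
    simp only [cycSets, Finset.mem_filter, Finset.mem_univ, true_and] at hS
    obtain ⟨⟨h1, h2⟩, h0⟩ := hS
    have hb := hbd S h2 h0
    conv_rhs => rw [← Finset.insert_erase h0]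
    congr 1
    rw [Finset.image_image]
    conv_rhs => rw [← Finset.image_id (s := S.erase 0)]
    apply Finset.image_congr
    intro x hx
    have hx := Finset.mem_erase.1 (Finset.mem_coe.1 hx)
    have a1 := hb x hx.2 hx.1
    simp only [Function.comp, id]
    rw [show x.val - (p+1) + p + 1 = x.val by omega]
    simp

/-- **Kaplansky's generalized theorem.**  Let `p, k ≥ 1` and `n ≥ pk + 1`.  The number of
`k`-element subsets `S` of `ZMod n` such that for every ordered pair `(x, y)` of distinct
elements of `S` the difference `x - y` (computed in `ZMod n`) does not belong to
`{1, 2, …, p}` equals `(n / (n - pk)) * C(n - pk, k)`. -/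
theorem statement2 (p k n : ℕ) (hp : 1 ≤ p) (hk : 1 ≤ k) (hn : p * k + 1 ≤ n) :
    (({S : Finset (ZMod n) | S.card = k ∧
        ∀ x ∈ S, ∀ y ∈ S, x ≠ y →
          ∀ a : ℕ, 1 ≤ a → a ≤ p → x - y ≠ (a : ZMod n)}.ncard : ℚ)) =
      (n : ℚ) / ((n - p * k : ℕ) : ℚ) * ((n - p * k).choose k : ℚ) := by
  have : NeZero n := ⟨by omega⟩
  have hS : {S : Finset (ZMod n) | S.card = k ∧
        ∀ x ∈ S, ∀ y ∈ S, x ≠ y →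
          ∀ a : ℕ, 1 ≤ a → a ≤ p → x - y ≠ (a : ZMod n)} = (cycSets p n k : Set _) := by
    ext S
    simp only [cycSets, Finset.mem_coe, Finset.mem_filter, Finset.mem_univ, true_and]
    exact Iff.rfl
  rw [hS, Set.ncard_coe_finset]
  obtain ⟨k, rfl⟩ : ∃ j, k = j + 1 := ⟨k - 1, by omega⟩
  have hle : p ≤ p * (k+1) := Nat.le_mul_of_pos_right _ (by omega)
  have h1 := double_count p n (k+1)
  rw [card_zero p n k (by omega), card_linSets] at h1
  obtain ⟨m, hm⟩ : ∃ m, n - p * (k+1) = m + 1 := ⟨n - p * (k+1) - 1, by omega⟩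
  have h2 : (n - 1 - 2 * p + p - p * k).choose k = m.choose k := by
    rcases k with _ | k
    · simp
    · congr 1
      have : p ≤ p * (k + 1) := Nat.le_mul_of_pos_right _ (by omega)
      rw [mul_add p (k+1) 1] at hm hn
      omega
  rw [h2] at h1
  rw [hm]
  have h3 := Nat.add_one_mul_choose_eq m k
  have h1' : ((k : ℚ) + 1) * (cycSets p n (k+1)).card = n * (m.choose k : ℚ) := by exact_mod_cast h1
  have h3' : ((m : ℚ) + 1) * (m.choose k : ℚ) = ((m+1).choose (k+1) : ℚ) * (k + 1) := by
    exact_mod_cast h3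
  have hk0 : (k : ℚ) + 1 ≠ 0 := by positivity
  have hm0 : (m : ℚ) + 1 ≠ 0 := by positivity
  push_cast
  rw [div_mul_eq_mul_div, eq_div_iff hm0]
  apply mul_left_cancel₀ hk0
  linear_combination ((m : ℚ) + 1) * h1' + n * h3'
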